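/- arXiv:1905.09448 — 2 statements merged into one kernel-verified Lean document; each statement's English description precedes it below -/
import Mathlib

section
/- Let ν > 1, φ, λ ∈ ℝ, and let α be a Θ_ν-distributed complex random variable. Then | E[ e^{iλΥ₁(φ,α)} ] − 1 + 4λ²(1 − cos φ)/(ν+1) | ≤ (64λ² + 416λ⁴)/((ν+1)(ν+3)), and moreover | E[ e^{iλΥ₁(φ,α)} ] − 1 | ≤ 16λ²/(ν+1). -/
open MeasureTheory ProbabilityTheory Filter

noncomputable section

/-- The Θ_ν distribution on ℂ: the measure on the open unit disk with density
`((ν−1)/(2π)) (1−|z|²)^{(ν−3)/2}` with respect to Lebesgue measure on ℂ. -/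
def thetaDist (ν : ℝ) : Measure ℂ :=
  (volume.restrict {z : ℂ | ‖z‖ < 1}).withDensity
    (fun z => ENNReal.ofReal ((ν - 1) / (2 * Real.pi) * (1 - ‖z‖ ^ 2) ^ ((ν - 3) / 2)))

/-- `Υ(ψ,α) = −2 Im log(1 − α e^{iψ})`. -/
def Upsilon (ψ : ℝ) (α : ℂ) : ℝ :=
  -2 * (Complex.log (1 - α * Complex.exp (Complex.I * (ψ : ℂ)))).im

/-- `Υ₁(ψ,α) = Υ(ψ,α) − Υ(0,α)`. -/
def Upsilon1 (ψ : ℝ) (α : ℂ) : ℝ := Upsilon ψ α - Upsilon 0 α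

/-- The Prüfer phases: `ψ_0(θ) = 0`, `ψ_{k+1}(θ) = ψ_k(θ) + θ + Υ₁(ψ_k(θ), γ_k)`. -/
def prufer {Ω : Type*} (γ : ℕ → Ω → ℂ) (θ : ℝ) : ℕ → Ω → ℝ
  | 0 => fun _ => 0
  | k + 1 => fun ω => prufer γ θ k ω + θ + Upsilon1 (prufer γ θ k ω) (γ k ω)

/-- The characteristic function `a_k(λ) = E[e^{iλ(ψ_k(θ) − (k+1)θ)}]` of the Prüfer phases. -/
def pruferChar {Ω : Type*} [MeasurableSpace Ω] (P : Measure Ω) (γ : ℕ → Ω → ℂ)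
    (θ : ℝ) (k : ℕ) (l : ℝ) : ℂ :=
  ∫ ω, Complex.exp (Complex.I * ((l * (prufer γ θ k ω - (k + 1) * θ) : ℝ) : ℂ)) ∂P

open Set Topology

theorem norm_le_of_norm_deriv_le_pow {f f' : ℝ → ℂ} (hf : ∀ x, HasDerivAt f (f' x) x)
    (h0 : f 0 = 0) {C : ℝ} {n : ℕ} (hf' : ∀ x, ‖f' x‖ ≤ C * |x| ^ n) (x : ℝ) :
    ‖f x‖ ≤ C / (n + 1) * |x| ^ (n + 1) := by
  have key : ∀ (g g' : ℝ → ℂ), (∀ x, HasDerivAt g (g' x) x) → g 0 = 0 →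
      (∀ x, ‖g' x‖ ≤ C * |x| ^ n) → ∀ x, 0 ≤ x → ‖g x‖ ≤ C / (n + 1) * x ^ (n + 1) := by
    intro g g' hg hg0 hg' x hx
    have hB : ∀ y : ℝ, HasDerivAt (fun y => C / (n + 1) * y ^ (n + 1)) (C * y ^ n) y := by
      intro y
      have := (hasDerivAt_pow (n + 1) y).const_mul (C / (n + 1))
      refine this.congr_deriv ?_
      rw [add_tsub_cancel_right]
      push_cast
      field_simp
    refine image_norm_le_of_norm_deriv_right_le_deriv_boundary (a := 0) (b := x)
      (f := g) (f' := g') (B' := fun y => C * y ^ n)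
      (fun y _ => (hg y).continuousAt.continuousWithinAt)
      (fun y _ => (hg y).hasDerivWithinAt) (by simp [hg0]) hB (fun y hy => ?_) ⟨hx, le_rfl⟩
    simpa [abs_of_nonneg hy.1] using hg' y
  rcases le_total 0 x with hx | hx
  · simpa [abs_of_nonneg hx] using key f f' hf h0 hf' x hx
  · have := key (fun y => f (-y)) (fun y => -f' (-y)) (fun y => ?_) (by simpa) (fun y => ?_) (-x)
      (by linarith)
    · simpa [abs_of_nonpos hx] using this
    · have := (hf (-y)).scomp y (hasDerivAt_neg y)
      simpa [Function.comp_def] using this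
    · simpa using hf' (-y)

theorem norm_exp_I_mul_sub_two_terms_le (x : ℝ) :
    ‖Complex.exp (Complex.I * x) - 1 - Complex.I * x‖ ≤ x ^ 2 / 2 := by
  have h := norm_le_of_norm_deriv_le_pow (n := 1) (C := 1)
    (f := fun x : ℝ => Complex.exp (Complex.I * x) - 1 - Complex.I * x)
    (f' := fun x => Complex.I * (Complex.exp (Complex.I * x) - 1)) (fun x => ?_) (by simp)
    (fun x => ?_) x
  · calc _ ≤ _ := h
      _ = _ := by rw [sq_abs]; norm_num; ring
  · have h1 : HasDerivAt (fun x : ℝ => Complex.I * (x : ℂ)) Complex.I x := by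
      simpa using (hasDerivAt_id x).ofReal_comp.const_mul Complex.I
    have := ((h1.cexp).sub_const 1).sub h1
    refine this.congr_deriv ?_
    ring
  · simpa using Real.norm_exp_I_mul_ofReal_sub_one_le (x := x)

theorem norm_exp_I_mul_sub_four_terms_le (x : ℝ) :
    ‖Complex.exp (Complex.I * x) - 1 - Complex.I * x + (x : ℂ) ^ 2 / 2
      + Complex.I * (x : ℂ) ^ 3 / 6‖ ≤ x ^ 4 / 24 := by
  have hx : ∀ x : ℝ, HasDerivAt (fun x : ℝ => (x : ℂ)) 1 x := fun x => by
    simpa using (hasDerivAt_id x).ofReal_comp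
  have hI : ∀ x : ℝ, HasDerivAt (fun x : ℝ => Complex.I * (x : ℂ)) Complex.I x := fun x => by
    simpa using (hx x).const_mul Complex.I
  have h3 : ∀ x : ℝ, ‖Complex.exp (Complex.I * x) - 1 - Complex.I * x + (x : ℂ) ^ 2 / 2‖
      ≤ 1 / 2 / ((2 : ℕ) + 1) * |x| ^ 3 := by
    refine norm_le_of_norm_deriv_le_pow (n := 2) (C := 1 / 2)
      (f' := fun x => Complex.I * (Complex.exp (Complex.I * x) - 1 - Complex.I * x))
      (fun x => ?_) (by simp) (fun x => ?_)
    · have := (((hI x).cexp.sub_const 1).sub (hI x)).add (((hx x).pow 2).div_const 2)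
      refine this.congr_deriv ?_
      push_cast
      linear_combination (x : ℂ) * Complex.I_sq
    · rw [norm_mul, Complex.norm_I, one_mul, sq_abs]
      linarith [norm_exp_I_mul_sub_two_terms_le x]
  have h := norm_le_of_norm_deriv_le_pow (n := 3) (C := 1 / 2 / ((2 : ℕ) + 1))
    (f := fun x : ℝ => Complex.exp (Complex.I * x) - 1 - Complex.I * x + (x : ℂ) ^ 2 / 2
      + Complex.I * (x : ℂ) ^ 3 / 6)
    (f' := fun x => Complex.I * (Complex.exp (Complex.I * x) - 1 - Complex.I * x + (x : ℂ) ^ 2 / 2))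
    (fun x => ?_) (by simp) (fun x => ?_) x
  · calc _ ≤ _ := h
      _ = _ := by rw [show |x| ^ (3 + 1) = (|x| ^ 2) ^ 2 by ring, sq_abs]; norm_num; ring
  · have := ((((hI x).cexp.sub_const 1).sub (hI x)).add (((hx x).pow 2).div_const 2)).add
      ((((hx x).pow 3).const_mul Complex.I).div_const 6)
    refine this.congr_deriv ?_
    push_cast
    linear_combination (x : ℂ) * Complex.I_sq
  · rw [norm_mul, Complex.norm_I, one_mul]
    exact h3 x

section CircleAverage

variable {T : Type*} [MeasurableSpace T] {m : Measure T} [IsProbabilityMeasure m] {c : T → ℂ}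

theorem integral_im_mul_pow_eq_zero (hcm : Measurable c) (hc1 : ∀ t, ‖c t‖ = 1)
    (hc : ∀ n : ℕ, n ≠ 0 → ∫ t, c t ^ n ∂m = 0) (a : ℂ) {n : ℕ} (hn : n ≠ 0) :
    ∫ t, (a * c t ^ n).im ∂m = 0 := by
  have hi : Integrable (fun t => a * c t ^ n) m :=
    .of_bound (by fun_prop) ‖a‖ (.of_forall fun t => by simp [hc1])
  have := Complex.imCLM.integral_comp_comm hi
  simp only [Complex.imCLM_apply] at this
  rw [this, integral_const_mul, hc n hn]
  simp

theorem integral_re_mul_pow_eq_zero (hcm : Measurable c) (hc1 : ∀ t, ‖c t‖ = 1)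
    (hc : ∀ n : ℕ, n ≠ 0 → ∫ t, c t ^ n ∂m = 0) (a : ℂ) {n : ℕ} (hn : n ≠ 0) :
    ∫ t, (a * c t ^ n).re ∂m = 0 := by
  rw [← integral_im_mul_pow_eq_zero hcm hc1 hc (Complex.I * a) hn]
  simp [mul_assoc]

theorem integral_im_mul_im (hcm : Measurable c) (hc1 : ∀ t, ‖c t‖ = 1)
    (hc : ∀ n : ℕ, n ≠ 0 → ∫ t, c t ^ n ∂m = 0) (a b : ℂ) {n k : ℕ} (hn : n ≠ 0) (hk : k ≠ 0) :
    ∫ t, (2 * (a * c t ^ n).im) * (2 * (b * c t ^ k).im) ∂m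
      = if n = k then 2 * (a * (starRingEnd ℂ) b).re else 0 := by
  have hint : ∀ (d : ℂ) (j : ℕ), Integrable (fun t => 2 * (d * c t ^ j).re) m := fun d j =>
    .of_bound (by fun_prop) (2 * ‖d‖) (.of_forall fun t => by
      have := Complex.abs_re_le_norm (d * c t ^ j)
      rw [norm_mul, norm_pow, hc1, one_pow, mul_one] at this
      simpa using this)
  have hcc : ∀ t, c t * (starRingEnd ℂ) (c t) = 1 := fun t => by
    rw [Complex.mul_conj, Complex.normSq_eq_norm_sq, hc1]; simp
  have hprod : ∀ x y : ℂ, (2 * x.im) * (2 * y.im)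
      = 2 * (x * (starRingEnd ℂ) y).re - 2 * (x * y).re := fun x y => by
    simp [Complex.mul_re]; ring
  have hlt : ∀ (a b : ℂ) (n k : ℕ), k ≤ n → ∀ t, (a * c t ^ n) * (starRingEnd ℂ) (b * c t ^ k)
      = (a * (starRingEnd ℂ) b) * c t ^ (n - k) := by
    intro a b n k hkn t
    obtain ⟨j, rfl⟩ := Nat.exists_eq_add_of_le hkn
    rw [add_tsub_cancel_left, map_mul, map_pow, pow_add]
    have := congrArg (· ^ k) (hcc t)
    simp only [mul_pow, one_pow] at this
    linear_combination (a * (starRingEnd ℂ) b * c t ^ j) * this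
  have hle : ∀ (a b : ℂ) (n k : ℕ), n ≠ 0 → k ≤ n →
      ∫ t, (2 * (a * c t ^ n).im) * (2 * (b * c t ^ k).im) ∂m
      = if n = k then 2 * (a * (starRingEnd ℂ) b).re else 0 := by
    intro a b n k hn hkn
    have h1 : ∀ t, (2 * (a * c t ^ n).im) * (2 * (b * c t ^ k).im)
        = 2 * ((a * (starRingEnd ℂ) b) * c t ^ (n - k)).re - 2 * ((a * b) * c t ^ (n + k)).re := by
      intro t
      rw [hprod, hlt a b n k hkn, pow_add]
      congr 3
      ring
    simp only [h1]
    rw [integral_sub (hint _ _) (hint _ _), integral_const_mul, integral_const_mul,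
      integral_re_mul_pow_eq_zero hcm hc1 hc _ (by omega : n + k ≠ 0)]
    split_ifs with h
    · simp [h]
    · rw [integral_re_mul_pow_eq_zero hcm hc1 hc _ (by omega : n - k ≠ 0)]
      simp
  rcases le_total k n with h | h
  · exact hle a b n k hn h
  · have := hle b a k n hk h
    simp only [mul_comm (2 * (a * c _ ^ n).im)]
    rw [this]
    simp only [eq_comm (a := k)]
    split_ifs
    · simp only [Complex.mul_re, Complex.conj_re, Complex.conj_im]; ring
    · rfl

variable {a : ℕ → ℂ} {X : T → ℝ}

theorem hasSum_integral_trigSeries_mul (hcm : Measurable c) (hc1 : ∀ t, ‖c t‖ = 1)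
    (ha : Summable fun n => ‖a n‖) (hX : ∀ t, HasSum (fun n => 2 * (a n * c t ^ n).im) (X t))
    {Y : T → ℝ} (hY : Measurable Y) {B : ℝ} (hYB : ∀ t, |Y t| ≤ B) :
    HasSum (fun n => ∫ t, 2 * (a n * c t ^ n).im * Y t ∂m) (∫ t, X t * Y t ∂m) := by
  refine hasSum_integral_of_dominated_convergence (fun n _ => 2 * ‖a n‖ * B)
    (fun n => (by fun_prop)) (fun n => .of_forall fun t => ?_)
    (.of_forall fun t => (ha.mul_left 2).mul_right B) (by simp)
    (.of_forall fun t => (hX t).mul_right _)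
  have := Complex.abs_im_le_norm (a n * c t ^ n)
  rw [norm_mul, norm_pow, hc1, one_pow, mul_one] at this
  rw [norm_mul, norm_mul, Real.norm_two, Real.norm_eq_abs, Real.norm_eq_abs]
  gcongr
  exact hYB t

theorem integral_trigSeries_eq_zero (hcm : Measurable c) (hc1 : ∀ t, ‖c t‖ = 1)
    (hc : ∀ n : ℕ, n ≠ 0 → ∫ t, c t ^ n ∂m = 0) (ha : Summable fun n => ‖a n‖) (ha0 : a 0 = 0)
    (hX : ∀ t, HasSum (fun n => 2 * (a n * c t ^ n).im) (X t)) : ∫ t, X t ∂m = 0 := by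
  have h := hasSum_integral_trigSeries_mul (m := m) hcm hc1 ha hX (Y := fun _ => 1)
    measurable_const (B := 1) (by simp)
  simp only [mul_one] at h
  refine h.unique ?_
  convert hasSum_zero with n
  rcases eq_or_ne n 0 with rfl | hn
  · simp [ha0]
  · rw [integral_const_mul, integral_im_mul_pow_eq_zero hcm hc1 hc _ hn, mul_zero]

theorem integral_trigSeries_mul_term (hcm : Measurable c) (hc1 : ∀ t, ‖c t‖ = 1)
    (hc : ∀ n : ℕ, n ≠ 0 → ∫ t, c t ^ n ∂m = 0) (ha : Summable fun n => ‖a n‖) (ha0 : a 0 = 0)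
    (hX : ∀ t, HasSum (fun n => 2 * (a n * c t ^ n).im) (X t)) (k : ℕ) :
    ∫ t, X t * (2 * (a k * c t ^ k).im) ∂m = 2 * ‖a k‖ ^ 2 := by
  rcases eq_or_ne k 0 with rfl | hk
  · simp [ha0]
  have h := hasSum_integral_trigSeries_mul (m := m) hcm hc1 ha hX
    (Y := fun t => 2 * (a k * c t ^ k).im) (by fun_prop) (B := 2 * ‖a k‖) (fun t => by
      have := Complex.abs_im_le_norm (a k * c t ^ k)
      rw [norm_mul, norm_pow, hc1, one_pow, mul_one] at this
      simpa [abs_mul] using this)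
  refine h.unique ?_
  convert hasSum_ite_eq k (2 * ‖a k‖ ^ 2) with n
  rcases eq_or_ne n 0 with rfl | hn
  · simp [ha0, hk.symm]
  rw [integral_im_mul_im hcm hc1 hc _ _ hn hk]
  split_ifs with hnk
  · subst hnk
    rw [Complex.mul_conj, Complex.normSq_eq_norm_sq, Complex.ofReal_re]
  · rfl

theorem measurable_of_hasSum_trig (hcm : Measurable c)
    (hX : ∀ t, HasSum (fun n => 2 * (a n * c t ^ n).im) (X t)) : Measurable X := by
  have : X = fun t => ∑' n, 2 * (a n * c t ^ n).im := funext fun t => (hX t).tsum_eq.symm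
  refine measurable_of_tendsto_metrizable (f := fun N t => ∑ n ∈ Finset.range N,
    2 * (a n * c t ^ n).im) (fun N => by fun_prop) ?_
  exact tendsto_pi_nhds.2 fun t => (hX t).tendsto_sum_nat

theorem hasSum_integral_trigSeries_sq (hcm : Measurable c) (hc1 : ∀ t, ‖c t‖ = 1)
    (hc : ∀ n : ℕ, n ≠ 0 → ∫ t, c t ^ n ∂m = 0) (ha : Summable fun n => ‖a n‖) (ha0 : a 0 = 0)
    (hX : ∀ t, HasSum (fun n => 2 * (a n * c t ^ n).im) (X t)) {B : ℝ} (hXB : ∀ t, |X t| ≤ B) :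
    HasSum (fun n => 2 * ‖a n‖ ^ 2) (∫ t, X t ^ 2 ∂m) := by
  have h := hasSum_integral_trigSeries_mul (m := m) hcm hc1 ha hX
    (measurable_of_hasSum_trig hcm hX) hXB
  simp only [← sq] at h
  convert h using 2 with n
  rw [← integral_trigSeries_mul_term hcm hc1 hc ha ha0 hX n]
  simp only [mul_comm]

theorem integral_im_pow_three_eq_zero (hcm : Measurable c) (hc1 : ∀ t, ‖c t‖ = 1)
    (hc : ∀ n : ℕ, n ≠ 0 → ∫ t, c t ^ n ∂m = 0) (b : ℂ) :
    ∫ t, (2 * (b * c t ^ 1).im) ^ 3 ∂m = 0 := by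
  have hint : ∀ (d : ℝ) (b : ℂ) (j : ℕ), Integrable (fun t => d * (b * c t ^ j).im) m :=
    fun d b j => .of_bound (by fun_prop) (|d| * ‖b‖) (.of_forall fun t => by
      have := Complex.abs_im_le_norm (b * c t ^ j)
      rw [norm_mul, norm_pow, hc1, one_pow, mul_one] at this
      rw [norm_mul, Real.norm_eq_abs, Real.norm_eq_abs]
      gcongr)
  have key : ∀ x : ℂ, (2 * x.im) ^ 3 = 6 * ‖x‖ ^ 2 * x.im - 2 * (x ^ 3).im := fun x => by
    rw [← Complex.normSq_eq_norm_sq, Complex.normSq_apply]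
    simp [pow_succ, Complex.mul_im, Complex.mul_re]
    ring
  have h1 : ∀ t, (2 * (b * c t ^ 1).im) ^ 3
      = 6 * ‖b‖ ^ 2 * (b * c t ^ 1).im - 2 * (b ^ 3 * c t ^ 3).im := fun t => by
    rw [key, norm_mul, norm_pow, hc1, pow_one, pow_one, mul_one, mul_pow b]
  simp only [h1]
  rw [integral_sub (hint _ _ _) (hint _ _ _), integral_const_mul, integral_const_mul,
    integral_im_mul_pow_eq_zero hcm hc1 hc _ one_ne_zero,
    integral_im_mul_pow_eq_zero hcm hc1 hc _ three_ne_zero]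
  simp

theorem tsum_sq_bounds {r : ℝ} (hr : 0 ≤ r) (hr1 : r ≤ 1) {s : ℝ}
    (har : ∀ n : ℕ, ‖a n‖ ≤ 2 * r ^ n / n) (hs : HasSum (fun n => 2 * ‖a n‖ ^ 2) s) :
    s ≤ 8 * (Real.pi ^ 2 / 6) * r ^ 2 ∧
      s - 2 * ‖a 1‖ ^ 2 ≤ 8 * (Real.pi ^ 2 / 6 - 1) * r ^ 4 := by
  have hterm : ∀ n k : ℕ, k ≤ n → 2 * ‖a n‖ ^ 2 ≤ 8 * r ^ (2 * k) * (1 / (n : ℝ) ^ 2) := by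
    intro n k hkn
    have h1 : ‖a n‖ ^ 2 ≤ (2 * r ^ n / n) ^ 2 := by gcongr; exact har n
    have h2 : r ^ (2 * n) ≤ r ^ (2 * k) := pow_le_pow_of_le_one hr hr1 (by omega)
    calc 2 * ‖a n‖ ^ 2 ≤ 2 * (2 * r ^ n / n) ^ 2 := by gcongr
      _ = 8 * r ^ (2 * n) * (1 / (n : ℝ) ^ 2) := by rw [div_pow, mul_pow, ← pow_mul]; ring
      _ ≤ _ := by gcongr
  have ha0 : ‖a 0‖ = 0 := le_antisymm (by simpa using har 0) (norm_nonneg _)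
  constructor
  · have := hasSum_le (fun n => ?_) hs (hasSum_zeta_two.mul_left (8 * r ^ (2 * 1)))
    · linarith
    · rcases Nat.eq_zero_or_pos n with rfl | hn
      · simp [ha0]
      · exact hterm n 1 hn
  · have h1 := hasSum_ite_sub_hasSum hs 1
    have h2 := hasSum_ite_sub_hasSum (hasSum_zeta_two.mul_left (8 * r ^ (2 * 2))) 1
    have := hasSum_le (fun n => ?_) h1 h2
    · norm_num at this
      linarith
    · split_ifs with h
      · rfl
      · rcases Nat.eq_zero_or_pos n with rfl | hn
        · simp [ha0]
        · exact hterm n 2 (by omega)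

theorem norm_integral_exp_trigSeries_sub_one_le (hcm : Measurable c) (hc1 : ∀ t, ‖c t‖ = 1)
    (hc : ∀ n : ℕ, n ≠ 0 → ∫ t, c t ^ n ∂m = 0) (ha : Summable fun n => ‖a n‖)
    {r : ℝ} (hr : 0 ≤ r) (hr1 : r ≤ 1) (har : ∀ n : ℕ, ‖a n‖ ≤ 2 * r ^ n / n)
    (hX : ∀ t, HasSum (fun n => 2 * (a n * c t ^ n).im) (X t)) {B : ℝ} (hXB : ∀ t, |X t| ≤ B)
    (l : ℝ) :
    ‖(∫ t, Complex.exp (Complex.I * ((l * X t : ℝ) : ℂ)) ∂m) - 1‖ ≤ 8 * l ^ 2 * r ^ 2 := by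
  have hXm := measurable_of_hasSum_trig hcm hX
  have ha0 : a 0 = 0 := norm_le_zero_iff.1 (by simpa using har 0)
  have hXi : Integrable X m := .of_bound (by fun_prop) B (.of_forall hXB)
  have hX2i : Integrable (fun t => X t ^ 2) m :=
    .of_bound (by fun_prop) (B ^ 2) (.of_forall fun t => by
      rw [Real.norm_eq_abs, abs_pow]; gcongr; exact hXB t)
  have hZi : Integrable (fun t => Complex.exp (Complex.I * ((l * X t : ℝ) : ℂ))) m :=
    .of_bound (by fun_prop) 1 (.of_forall fun t => by rw [Complex.norm_exp_I_mul_ofReal])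
  have hE : (∫ t, Complex.exp (Complex.I * ((l * X t : ℝ) : ℂ)) ∂m) - 1
      = ∫ t, (Complex.exp (Complex.I * ((l * X t : ℝ) : ℂ)) - 1
        - Complex.I * ((l * X t : ℝ) : ℂ)) ∂m := by
    have hZ1 : Integrable (fun t => Complex.exp (Complex.I * ((l * X t : ℝ) : ℂ)) - 1) m :=
      hZi.sub (integrable_const _)
    have hIX : Integrable (fun t => Complex.I * ((l * X t : ℝ) : ℂ)) m :=
      (hXi.const_mul l).ofReal.const_mul _
    rw [integral_sub hZ1 hIX,
      integral_sub hZi (integrable_const _), integral_const_mul, integral_complex_ofReal,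
      integral_const_mul, integral_trigSeries_eq_zero hcm hc1 hc ha ha0 hX]
    simp
  rw [hE]
  have h2 := (tsum_sq_bounds hr hr1 har
    (hasSum_integral_trigSeries_sq (m := m) hcm hc1 hc ha ha0 hX hXB)).1
  calc _ ≤ ∫ t, l ^ 2 / 2 * X t ^ 2 ∂m :=
        norm_integral_le_of_norm_le (hX2i.const_mul _) (.of_forall fun t =>
          (norm_exp_I_mul_sub_two_terms_le (l * X t)).trans_eq (by ring))
    _ = l ^ 2 / 2 * ∫ t, X t ^ 2 ∂m := integral_const_mul _ _
    _ ≤ l ^ 2 / 2 * (8 * (3.15 ^ 2 / 6) * r ^ 2) := by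
        gcongr
        refine h2.trans ?_
        gcongr
        exact Real.pi_lt_d2.le
    _ ≤ 8 * l ^ 2 * r ^ 2 := by nlinarith [mul_nonneg (sq_nonneg l) (sq_nonneg r)]

theorem norm_exp_I_mul_sub_cubic_le (l x y : ℝ) :
    ‖Complex.exp (Complex.I * ((l * x : ℝ) : ℂ)) - 1 - Complex.I * ((l * x : ℝ) : ℂ)
      + ((l ^ 2 / 2 * x ^ 2 : ℝ) : ℂ) + Complex.I * ((l ^ 3 / 6 * y ^ 3 : ℝ) : ℂ)‖
      ≤ 7 / 8 * l ^ 2 * (x - y) ^ 2 + l ^ 4 * (13 / 168 * x ^ 4 + 1 / 28 * y ^ 4) := by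
  have h1 := norm_exp_I_mul_sub_four_terms_le (l * x)
  have hcub : |x ^ 3 - y ^ 3| ≤ |x - y| * (3 / 2 * (x ^ 2 + y ^ 2)) := by
    rw [show x ^ 3 - y ^ 3 = (x - y) * (x ^ 2 + x * y + y ^ 2) by ring, abs_mul]
    gcongr
    rw [abs_le]
    constructor <;> nlinarith [sq_nonneg (x - y), sq_nonneg (x + y), sq_nonneg x, sq_nonneg y]
  have h2 : ‖Complex.I * ((l ^ 3 / 6 * (y ^ 3 - x ^ 3) : ℝ) : ℂ)‖
      ≤ 7 / 8 * l ^ 2 * (x - y) ^ 2 + l ^ 4 * (1 / 28 * x ^ 4 + 1 / 28 * y ^ 4) := by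
    rw [norm_mul, Complex.norm_I, one_mul, Complex.norm_real, Real.norm_eq_abs, abs_mul,
      abs_div, abs_pow, abs_sub_comm (y ^ 3)]
    calc |l| ^ 3 / |6| * |x ^ 3 - y ^ 3|
        ≤ |l| ^ 3 / |6| * (|x - y| * (3 / 2 * (x ^ 2 + y ^ 2))) := by gcongr
      _ = (|l| * |x - y|) * (|l| ^ 2 * (x ^ 2 + y ^ 2)) / 4 := by
          rw [abs_of_pos (by norm_num : (0 : ℝ) < 6)]; ring
      _ ≤ (7 / 2 * (|l| * |x - y|) ^ 2 + (|l| ^ 2 * (x ^ 2 + y ^ 2)) ^ 2 / 14) / 4 := by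
          nlinarith [sq_nonneg (7 * (|l| * |x - y|) - |l| ^ 2 * (x ^ 2 + y ^ 2))]
      _ = 7 / 8 * l ^ 2 * (x - y) ^ 2 + l ^ 4 * (x ^ 2 + y ^ 2) ^ 2 / 56 := by
          rw [mul_pow, sq_abs, sq_abs]; ring
      _ ≤ _ := by
          have : (x ^ 2 + y ^ 2) ^ 2 ≤ 2 * (x ^ 4 + y ^ 4) := by
            nlinarith [sq_nonneg (x ^ 2 - y ^ 2)]
          have := mul_le_mul_of_nonneg_left this (by positivity : 0 ≤ l ^ 4)
          linarith
  calc _ = ‖(Complex.exp (Complex.I * ((l * x : ℝ) : ℂ)) - 1 - Complex.I * ((l * x : ℝ) : ℂ)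
        + ((l * x : ℝ) : ℂ) ^ 2 / 2 + Complex.I * ((l * x : ℝ) : ℂ) ^ 3 / 6)
        + Complex.I * ((l ^ 3 / 6 * (y ^ 3 - x ^ 3) : ℝ) : ℂ)‖ := by
          congr 1; push_cast; ring
    _ ≤ _ := norm_add_le _ _
    _ ≤ _ := add_le_add h1 h2
    _ = _ := by ring

theorem norm_integral_exp_trigSeries_sub_le (hcm : Measurable c) (hc1 : ∀ t, ‖c t‖ = 1)
    (hc : ∀ n : ℕ, n ≠ 0 → ∫ t, c t ^ n ∂m = 0) (ha : Summable fun n => ‖a n‖)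
    {r : ℝ} (hr : 0 ≤ r) (hr1 : r ≤ 1) (har : ∀ n : ℕ, ‖a n‖ ≤ 2 * r ^ n / n)
    (hX : ∀ t, HasSum (fun n => 2 * (a n * c t ^ n).im) (X t))
    (hXB : ∀ t, |X t| ≤ 2 * Real.pi * r) (l : ℝ) :
    ‖(∫ t, Complex.exp (Complex.I * ((l * X t : ℝ) : ℂ)) ∂m) - 1 + ((l ^ 2 * ‖a 1‖ ^ 2 : ℝ) : ℂ)‖
      ≤ (8 * l ^ 2 + 52 * l ^ 4) * r ^ 4 := by
  have hXm := measurable_of_hasSum_trig hcm hX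
  have ha0 : a 0 = 0 := norm_le_zero_iff.1 (by simpa using har 0)
  set L : T → ℝ := fun t => 2 * (a 1 * c t ^ 1).im with hL
  have hLm : Measurable L := by fun_prop
  have ha1 : ‖a 1‖ ≤ 2 * r := by simpa using har 1
  have hLB : ∀ t, |L t| ≤ 4 * r := fun t => by
    have := Complex.abs_im_le_norm (a 1 * c t ^ 1)
    rw [norm_mul, norm_pow, hc1, one_pow, mul_one] at this
    rw [hL, abs_mul, abs_two]
    linarith
  have hint : ∀ i j : ℕ, Integrable (fun t => X t ^ i * L t ^ j) m := fun i j =>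
    .of_bound (by fun_prop) ((2 * Real.pi * r) ^ i * (4 * r) ^ j) (.of_forall fun t => by
      rw [Real.norm_eq_abs, abs_mul, abs_pow, abs_pow]
      gcongr
      exacts [hXB t, hLB t])
  have hXp : ∀ i : ℕ, Integrable (fun t => X t ^ i) m := fun i => by simpa using hint i 0
  have hLp : ∀ j : ℕ, Integrable (fun t => L t ^ j) m := fun j => by simpa using hint 0 j
  have hXi : Integrable X m := by simpa using hXp 1
  have hXL : Integrable (fun t => X t * L t) m := by simpa using hint 1 1
  have hZi : Integrable (fun t => Complex.exp (Complex.I * ((l * X t : ℝ) : ℂ))) m :=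
    .of_bound (by fun_prop) 1 (.of_forall fun t => by rw [Complex.norm_exp_I_mul_ofReal])
  obtain ⟨hX2, hR2⟩ := tsum_sq_bounds hr hr1 har
    (hasSum_integral_trigSeries_sq (m := m) hcm hc1 hc ha ha0 hX hXB)
  have hXLint : ∫ t, X t * L t ∂m = 2 * ‖a 1‖ ^ 2 :=
    integral_trigSeries_mul_term hcm hc1 hc ha ha0 hX 1
  have hL2int : ∫ t, L t ^ 2 ∂m = 2 * ‖a 1‖ ^ 2 := by
    simp only [sq]
    rw [hL, integral_im_mul_im hcm hc1 hc _ _ one_ne_zero one_ne_zero, if_pos rfl,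
      Complex.mul_conj, Complex.normSq_eq_norm_sq, Complex.ofReal_re, sq]
  have hRi : Integrable (fun t => (X t - L t) ^ 2) m := by
    have := ((hXp 2).sub (hXL.const_mul 2)).add (hLp 2)
    refine this.congr (.of_forall fun t => ?_)
    simp only [Pi.add_apply, Pi.sub_apply]
    ring
  have hRint : ∫ t, (X t - L t) ^ 2 ∂m = (∫ t, X t ^ 2 ∂m) - 2 * ‖a 1‖ ^ 2 := by
    have : ∀ t, (X t - L t) ^ 2 = X t ^ 2 - 2 * (X t * L t) + L t ^ 2 := fun t => by ring
    simp only [this]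
    have hi : Integrable (fun t => X t ^ 2 - 2 * (X t * L t)) m := (hXp 2).sub (hXL.const_mul 2)
    rw [integral_add hi (hLp 2),
      integral_sub (hXp 2) (hXL.const_mul 2), integral_const_mul, hXLint, hL2int]
    ring
  have hX4 : ∫ t, X t ^ 4 ∂m ≤ (2 * Real.pi * r) ^ 2 * ∫ t, X t ^ 2 ∂m := by
    rw [← integral_const_mul]
    refine integral_mono (hXp 4) ((hXp 2).const_mul _) fun t => ?_
    have := sq_le_sq' (neg_le_of_abs_le (hXB t)) (le_of_abs_le (hXB t))
    nlinarith [mul_le_mul_of_nonneg_right this (sq_nonneg (X t))]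
  have hL4 : ∫ t, L t ^ 4 ∂m ≤ (4 * r) ^ 2 * ∫ t, L t ^ 2 ∂m := by
    rw [← integral_const_mul]
    refine integral_mono (hLp 4) ((hLp 2).const_mul _) fun t => ?_
    have := sq_le_sq' (neg_le_of_abs_le (hLB t)) (le_of_abs_le (hLB t))
    nlinarith [mul_le_mul_of_nonneg_right this (sq_nonneg (L t))]
  have hL4' : ∫ t, L t ^ 4 ∂m ≤ 128 * r ^ 4 := by
    have : ‖a 1‖ ^ 2 ≤ (2 * r) ^ 2 := by gcongr
    rw [hL2int] at hL4
    nlinarith [mul_le_mul_of_nonneg_left this (sq_nonneg r)]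
  have hpi : Real.pi ^ 2 ≤ 3.15 ^ 2 := by gcongr; exact Real.pi_lt_d2.le
  have hX4' : ∫ t, X t ^ 4 ∂m ≤ 526 * r ^ 4 := by
    calc _ ≤ _ := hX4
      _ ≤ (2 * Real.pi * r) ^ 2 * (8 * (Real.pi ^ 2 / 6) * r ^ 2) := by gcongr
      _ = 16 / 3 * (Real.pi ^ 2) ^ 2 * r ^ 4 := by ring
      _ ≤ 16 / 3 * (3.15 ^ 2) ^ 2 * r ^ 4 := by gcongr
      _ ≤ _ := by gcongr; norm_num
  have hR2' : (∫ t, X t ^ 2 ∂m) - 2 * ‖a 1‖ ^ 2 ≤ 5.24 * r ^ 4 := by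
    refine hR2.trans ?_
    gcongr
    linarith
  set Q : T → ℝ := fun t => 7 / 8 * l ^ 2 * (X t - L t) ^ 2
    + l ^ 4 * (13 / 168 * X t ^ 4 + 1 / 28 * L t ^ 4) with hQ
  have hXLi : Integrable (fun t => 13 / 168 * X t ^ 4 + 1 / 28 * L t ^ 4) m :=
    ((hXp 4).const_mul _).add ((hLp 4).const_mul _)
  have hQi : Integrable Q m := (hRi.const_mul _).add (hXLi.const_mul _)
  have hQint : ∫ t, Q t ∂m ≤ 7 / 8 * l ^ 2 * (5.24 * r ^ 4)
      + l ^ 4 * (13 / 168 * (526 * r ^ 4) + 1 / 28 * (128 * r ^ 4)) := by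
    rw [hQ, integral_add (hRi.const_mul _) (hXLi.const_mul _), integral_const_mul,
      integral_const_mul, integral_add ((hXp 4).const_mul _) ((hLp 4).const_mul _),
      integral_const_mul, integral_const_mul, hRint]
    gcongr
  have hE : (∫ t, Complex.exp (Complex.I * ((l * X t : ℝ) : ℂ)) ∂m) - 1
        + ((l ^ 2 * ‖a 1‖ ^ 2 : ℝ) : ℂ)
      = (∫ t, (Complex.exp (Complex.I * ((l * X t : ℝ) : ℂ)) - 1
        - Complex.I * ((l * X t : ℝ) : ℂ) + ((l ^ 2 / 2 * X t ^ 2 : ℝ) : ℂ)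
        + Complex.I * ((l ^ 3 / 6 * L t ^ 3 : ℝ) : ℂ)) ∂m)
        - ((l ^ 2 / 2 * ((∫ t, X t ^ 2 ∂m) - 2 * ‖a 1‖ ^ 2) : ℝ) : ℂ) := by
    have i1 : Integrable (fun t => Complex.exp (Complex.I * ((l * X t : ℝ) : ℂ)) - 1) m :=
      hZi.sub (integrable_const _)
    have i2 : Integrable (fun t => Complex.I * ((l * X t : ℝ) : ℂ)) m :=
      (hXi.const_mul l).ofReal.const_mul _
    have i3 : Integrable (fun t => ((l ^ 2 / 2 * X t ^ 2 : ℝ) : ℂ)) m :=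
      ((hXp 2).const_mul _).ofReal
    have i4 : Integrable (fun t => Complex.I * ((l ^ 3 / 6 * L t ^ 3 : ℝ) : ℂ)) m :=
      ((hLp 3).const_mul _).ofReal.const_mul _
    have i12 : Integrable (fun t => Complex.exp (Complex.I * ((l * X t : ℝ) : ℂ)) - 1
        - Complex.I * ((l * X t : ℝ) : ℂ)) m := i1.sub i2
    rw [integral_add (i12.fun_add i3) i4, integral_add i12 i3, integral_sub i1 i2,
      integral_sub hZi (integrable_const _), integral_const_mul, integral_const_mul,
      integral_complex_ofReal, integral_complex_ofReal, integral_complex_ofReal,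
      integral_const_mul, integral_const_mul, integral_const_mul,
      integral_trigSeries_eq_zero hcm hc1 hc ha ha0 hX, hL,
      integral_im_pow_three_eq_zero hcm hc1 hc]
    simp
    ring
  rw [hE]
  have hRnn : 0 ≤ (∫ t, X t ^ 2 ∂m) - 2 * ‖a 1‖ ^ 2 := by
    rw [← hRint]; exact integral_nonneg fun t => sq_nonneg _
  calc _ ≤ _ := norm_sub_le _ _
    _ ≤ (∫ t, Q t ∂m) + l ^ 2 / 2 * (5.24 * r ^ 4) := by
        refine add_le_add (norm_integral_le_of_norm_le hQi
          (.of_forall fun t => norm_exp_I_mul_sub_cubic_le l (X t) (L t))) ?_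
        rw [Complex.norm_real, Real.norm_of_nonneg (by positivity)]
        gcongr
    _ ≤ _ := by
        have := mul_nonneg (sq_nonneg l) (pow_nonneg hr 4)
        have := mul_nonneg (sq_nonneg (l ^ 2)) (pow_nonneg hr 4)
        nlinarith

end CircleAverage

theorem abs_arg_one_sub_le {w : ℂ} (hw : ‖w‖ < 1) :
    |Complex.arg (1 - w)| ≤ Real.pi / 2 * ‖w‖ := by
  have hre : 0 < (1 - w).re := by
    have := Complex.re_le_norm w
    simp only [Complex.sub_re, Complex.one_re]
    linarith
  have hne : 0 < ‖1 - w‖ := norm_pos_iff.2 fun h => by simp [h] at hre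
  have hratio : |(1 - w).im / ‖1 - w‖| ≤ ‖w‖ := by
    rw [abs_div, abs_norm, div_le_iff₀ hne]
    refine abs_le_of_sq_le_sq ?_ (by positivity)
    rw [mul_pow, ← Complex.normSq_eq_norm_sq, ← Complex.normSq_eq_norm_sq, Complex.normSq_apply,
      Complex.normSq_apply]
    simp only [Complex.sub_re, Complex.one_re, Complex.sub_im, Complex.one_im]
    nlinarith [sq_nonneg (w.re - (w.re * w.re + w.im * w.im))]
  have hpi : |Complex.arg (1 - w)| ≤ Real.pi / 2 :=
    (Complex.abs_arg_lt_pi_div_two_iff.2 (Or.inl hre)).le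
  have hsin : Real.sin |Complex.arg (1 - w)| ≤ ‖w‖ := by
    refine le_trans ?_ hratio
    rw [← Complex.sin_arg]
    rcases abs_cases (Complex.arg (1 - w)) with ⟨h, -⟩ | ⟨h, -⟩
    · rw [h]; exact le_abs_self _
    · rw [h, Real.sin_neg]; exact neg_le_abs _
  have := (Real.mul_le_sin (abs_nonneg _) hpi).trans hsin
  have hp := Real.pi_pos
  rw [div_mul_eq_mul_div, div_le_iff₀ hp] at this
  linarith

theorem norm_mul_exp_I (ψ : ℝ) (α : ℂ) : ‖α * Complex.exp (Complex.I * (ψ : ℂ))‖ = ‖α‖ := by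
  rw [norm_mul, Complex.norm_exp_I_mul_ofReal, mul_one]

theorem abs_Upsilon_le (ψ : ℝ) {α : ℂ} (hα : ‖α‖ < 1) : |Upsilon ψ α| ≤ Real.pi * ‖α‖ := by
  have h := abs_arg_one_sub_le (w := α * Complex.exp (Complex.I * (ψ : ℂ)))
    (by rwa [norm_mul_exp_I])
  rw [norm_mul_exp_I] at h
  rw [Upsilon, Complex.log_im, abs_mul, abs_neg, abs_two]
  linarith

theorem abs_Upsilon1_le (ψ : ℝ) {α : ℂ} (hα : ‖α‖ < 1) :
    |Upsilon1 ψ α| ≤ 2 * Real.pi * ‖α‖ := by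
  have := abs_sub (Upsilon ψ α) (Upsilon 0 α)
  rw [Upsilon1]
  linarith [abs_Upsilon_le ψ hα, abs_Upsilon_le 0 hα]

theorem hasSum_Upsilon (ψ : ℝ) {α : ℂ} (hα : ‖α‖ < 1) :
    HasSum (fun n : ℕ => 2 * ((α * Complex.exp (Complex.I * (ψ : ℂ))) ^ n / n).im)
      (Upsilon ψ α) := by
  have h := (Complex.hasSum_im (Complex.hasSum_taylorSeries_neg_log
    (z := α * Complex.exp (Complex.I * (ψ : ℂ))) (by rwa [norm_mul_exp_I]))).mul_left 2
  rwa [Complex.neg_im, mul_neg, ← neg_mul] at h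

theorem hasSum_Upsilon1 (φ : ℝ) {α c : ℂ} (hα : ‖α‖ < 1) (hc : ‖c‖ = 1) :
    HasSum (fun n : ℕ => 2 * ((Complex.exp (Complex.I * (φ : ℂ)) ^ n - 1) * α ^ n / n * c ^ n).im)
      (Upsilon1 φ (c * α)) := by
  have hcα : ‖c * α‖ < 1 := by rwa [norm_mul, hc, one_mul]
  refine ((hasSum_Upsilon φ hcα).sub (hasSum_Upsilon 0 hcα)).congr_fun fun n => ?_
  rw [← mul_sub, ← Complex.sub_im]
  congr 2
  simp only [Complex.ofReal_zero, mul_zero, Complex.exp_zero, mul_pow, mul_one]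
  ring

theorem norm_Upsilon1_coeff_le (φ : ℝ) (α : ℂ) (n : ℕ) :
    ‖(Complex.exp (Complex.I * (φ : ℂ)) ^ n - 1) * α ^ n / n‖ ≤ 2 * ‖α‖ ^ n / n := by
  rw [norm_div, norm_mul, norm_pow, Complex.norm_natCast]
  gcongr
  refine (norm_sub_le _ _).trans ?_
  rw [norm_pow, Complex.norm_exp_I_mul_ofReal, one_pow, norm_one]
  norm_num

theorem norm_exp_I_sub_one_sq (φ : ℝ) :
    ‖Complex.exp (Complex.I * (φ : ℂ)) - 1‖ ^ 2 = 2 * (1 - Real.cos φ) := by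
  rw [mul_comm, Complex.exp_mul_I, ← Complex.normSq_eq_norm_sq, Complex.normSq_apply]
  simp only [Complex.sub_re, Complex.add_re, Complex.mul_re, Complex.sub_im, Complex.add_im,
    Complex.mul_im, Complex.cos_ofReal_re, Complex.sin_ofReal_re, Complex.cos_ofReal_im,
    Complex.sin_ofReal_im, Complex.I_re, Complex.I_im, Complex.one_re, Complex.one_im]
  nlinarith [Real.sin_sq_add_cos_sq φ]

theorem integral_exp_two_pi_pow_eq_zero {n : ℕ} (hn : n ≠ 0) :
    ∫ t in Ioc (0 : ℝ) 1, Complex.exp (Complex.I * ((2 * Real.pi * t : ℝ) : ℂ)) ^ n = 0 := by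
  have hne : (n : ℂ) * (2 * Real.pi * Complex.I) ≠ 0 :=
    mul_ne_zero (by exact_mod_cast hn) Complex.two_pi_I_ne_zero
  have : ∀ t : ℝ, Complex.exp (Complex.I * ((2 * Real.pi * t : ℝ) : ℂ)) ^ n
      = Complex.exp ((n : ℂ) * (2 * Real.pi * Complex.I) * t) := fun t => by
    rw [← Complex.exp_nat_mul]
    push_cast
    ring_nf
  simp only [this]
  rw [← intervalIntegral.integral_of_le zero_le_one, integral_exp_mul_complex hne]
  simp [Complex.exp_nat_mul_two_pi_mul_I]

/-- The averages of `e^{iλΥ₁(φ,·)}` over the circle of radius `‖α‖`. -/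
theorem circle_average_Upsilon1_bounds (φ l : ℝ) {α : ℂ} (hα : ‖α‖ < 1) :
    ‖(∫ t in Ioc (0 : ℝ) 1, Complex.exp (Complex.I *
        ((l * Upsilon1 φ (Complex.exp (Complex.I * ((2 * Real.pi * t : ℝ) : ℂ)) * α) : ℝ) : ℂ)))
        - 1 + ((2 * l ^ 2 * (1 - Real.cos φ) * ‖α‖ ^ 2 : ℝ) : ℂ)‖
      ≤ (8 * l ^ 2 + 52 * l ^ 4) * ‖α‖ ^ 4 ∧
    ‖(∫ t in Ioc (0 : ℝ) 1, Complex.exp (Complex.I *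
        ((l * Upsilon1 φ (Complex.exp (Complex.I * ((2 * Real.pi * t : ℝ) : ℂ)) * α) : ℝ) : ℂ)))
        - 1‖ ≤ 8 * l ^ 2 * ‖α‖ ^ 2 := by
  have : IsProbabilityMeasure ((volume : Measure ℝ).restrict (Ioc 0 1)) := ⟨by simp⟩
  set c : ℝ → ℂ := fun t => Complex.exp (Complex.I * ((2 * Real.pi * t : ℝ) : ℂ)) with hcdef
  set a : ℕ → ℂ := fun n => (Complex.exp (Complex.I * (φ : ℂ)) ^ n - 1) * α ^ n / n with hadef
  have hcm : Measurable c := by fun_prop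
  have hc1 : ∀ t, ‖c t‖ = 1 := fun t => Complex.norm_exp_I_mul_ofReal _
  have har : ∀ n, ‖a n‖ ≤ 2 * ‖α‖ ^ n / n := norm_Upsilon1_coeff_le φ α
  have ha : Summable fun n => ‖a n‖ := by
    refine .of_nonneg_of_le (fun n => norm_nonneg _) (fun n => ?_)
      ((summable_geometric_of_lt_one (norm_nonneg α) hα).mul_left 2)
    refine (har n).trans ?_
    rcases Nat.eq_zero_or_pos n with rfl | hn
    · simp
    · exact div_le_self (by positivity) (by exact_mod_cast hn)
  have hX : ∀ t, HasSum (fun n => 2 * (a n * c t ^ n).im) (Upsilon1 φ (c t * α)) := fun t =>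
    hasSum_Upsilon1 φ hα (hc1 t)
  have hXB : ∀ t, |Upsilon1 φ (c t * α)| ≤ 2 * Real.pi * ‖α‖ := fun t => by
    have hn : ‖c t * α‖ = ‖α‖ := by rw [norm_mul, hc1, one_mul]
    exact hn ▸ abs_Upsilon1_le φ (hn.trans_lt hα)
  have hc0 : ∀ n : ℕ, n ≠ 0 → ∫ t in Ioc (0 : ℝ) 1, c t ^ n = 0 := fun n hn =>
    integral_exp_two_pi_pow_eq_zero hn
  have ha1 : ‖a 1‖ ^ 2 = 2 * (1 - Real.cos φ) * ‖α‖ ^ 2 := by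
    simp [hadef, mul_pow, norm_exp_I_sub_one_sq]
  refine ⟨?_, norm_integral_exp_trigSeries_sub_one_le hcm hc1 hc0 ha (norm_nonneg α) hα.le har
    hX hXB l⟩
  have := norm_integral_exp_trigSeries_sub_le hcm hc1 hc0 ha (norm_nonneg α) hα.le har hX hXB l
  rwa [ha1, show l ^ 2 * (2 * (1 - Real.cos φ) * ‖α‖ ^ 2)
    = 2 * l ^ 2 * (1 - Real.cos φ) * ‖α‖ ^ 2 by ring] at this

theorem integral_mul_one_sub_sq_rpow {s : ℝ} (hs : 0 < s) :
    ∫ y in Ioo (0 : ℝ) 1, y * (1 - y ^ 2) ^ (s - 1) = 1 / (2 * s) := by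
  set G : ℝ → ℝ := fun y => -((1 - y ^ 2) ^ s / (2 * s)) with hG
  have hcont : ContinuousOn G (Icc 0 1) := by
    refine ((ContinuousOn.rpow_const (by fun_prop) fun _ _ => Or.inr hs.le).div_const _).neg
  have hderiv : ∀ y ∈ Ioo (0 : ℝ) 1, HasDerivAt G (y * (1 - y ^ 2) ^ (s - 1)) y := by
    intro y hy
    have hpos : 0 < 1 - y ^ 2 := by nlinarith [hy.1, hy.2]
    have h1 : HasDerivAt (fun y : ℝ => 1 - y ^ 2) (-(2 * y)) y := by
      simpa using (hasDerivAt_pow 2 y).const_sub 1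
    have h2 := ((h1.rpow_const (p := s) (Or.inl hpos.ne')).div_const (2 * s)).neg
    refine h2.congr_deriv ?_
    field_simp
  have hint := (intervalIntegrable_iff_integrableOn_Ioc_of_le zero_le_one).2
    (intervalIntegral.integrableOn_deriv_of_nonneg hcont hderiv fun y hy =>
      mul_nonneg hy.1.le (Real.rpow_nonneg (by nlinarith [hy.1, hy.2]) _))
  rw [← integral_Ioc_eq_integral_Ioo, ← intervalIntegral.integral_of_le zero_le_one,
    intervalIntegral.integral_eq_sub_of_hasDerivAt_of_le zero_le_one hcont hderiv hint]
  simp [hG, Real.zero_rpow hs.ne']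

theorem measurable_thetaDensity (ν : ℝ) : Measurable fun z : ℂ =>
    ENNReal.ofReal ((ν - 1) / (2 * Real.pi) * (1 - ‖z‖ ^ 2) ^ ((ν - 3) / 2)) := by
  fun_prop

theorem integral_thetaDist_one_sub_sq_pow {ν : ℝ} (hν : 1 < ν) (j : ℕ) :
    ∫ z, (1 - ‖z‖ ^ 2) ^ j ∂(thetaDist ν) = (ν - 1) / (ν - 1 + 2 * j) := by
  have hD : MeasurableSet {z : ℂ | ‖z‖ < 1} := measurableSet_lt measurable_norm measurable_const
  rw [thetaDist, integral_withDensity_eq_integral_toReal_smul (measurable_thetaDensity ν)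
    (.of_forall fun _ => ENNReal.ofReal_lt_top), ← integral_indicator hD]
  set h : ℝ → ℝ := (Iio 1).indicator fun y =>
    (ENNReal.ofReal ((ν - 1) / (2 * Real.pi) * (1 - y ^ 2) ^ ((ν - 3) / 2))).toReal
      • (1 - y ^ 2) ^ j with hh
  have h1 : ({z : ℂ | ‖z‖ < 1}.indicator fun z : ℂ =>
      (ENNReal.ofReal ((ν - 1) / (2 * Real.pi) * (1 - ‖z‖ ^ 2) ^ ((ν - 3) / 2))).toReal
      • (1 - ‖z‖ ^ 2) ^ j) = fun z => h ‖z‖ := by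
    funext z
    simp only [hh, indicator_apply, mem_ofPred_eq, mem_Iio]
  rw [h1, integral_fun_norm_addHaar volume h, Complex.finrank_real_complex]
  have hball : (volume : Measure ℂ).real (Metric.ball 0 1) = Real.pi := by
    simp [Measure.real, Complex.volume_ball]
  have hs : 0 < (ν - 1) / 2 + j := by have : (0 : ℝ) ≤ j := j.cast_nonneg; linarith
  have h2 : ∫ y in Ioi (0 : ℝ), y ^ (2 - 1) • h y
      = ∫ y in Ioo (0 : ℝ) 1, (ν - 1) / (2 * Real.pi) *
        (y * (1 - y ^ 2) ^ ((ν - 1) / 2 + j - 1)) := by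
    rw [← Ioi_inter_Iio, ← setIntegral_indicator measurableSet_Iio]
    refine setIntegral_congr_fun measurableSet_Ioi fun y hy => ?_
    simp only [hh, indicator_apply, mem_Iio]
    split_ifs with hy1
    · have hpos : 0 < 1 - y ^ 2 := by
        have : 0 < y := hy
        nlinarith
      have hν' : 0 ≤ (ν - 1) / (2 * Real.pi) :=
        div_nonneg (by linarith) (by have := Real.pi_pos; positivity)
      rw [ENNReal.toReal_ofReal (mul_nonneg hν' (Real.rpow_nonneg hpos.le _)),
        show (ν - 1) / 2 + (j : ℝ) - 1 = (ν - 3) / 2 + j by ring, Real.rpow_add hpos,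
        Real.rpow_natCast]
      simp only [smul_eq_mul]
      ring
    · simp
  rw [h2, integral_const_mul, integral_mul_one_sub_sq_rpow hs, hball]
  have hp := Real.pi_pos
  have : 0 < ν - 1 + 2 * j := by linarith
  simp only [smul_eq_mul, nsmul_eq_mul]
  push_cast
  field_simp

theorem isProbabilityMeasure_thetaDist {ν : ℝ} (hν : 1 < ν) :
    IsProbabilityMeasure (thetaDist ν) := by
  have h := integral_thetaDist_one_sub_sq_pow hν 0
  have : ν - 1 ≠ 0 := by linarith
  simp only [pow_zero, integral_const, smul_eq_mul, mul_one, Nat.cast_zero, mul_zero, add_zero,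
    div_self this] at h
  exact ⟨by rwa [Measure.real, ENNReal.toReal_eq_one_iff] at h⟩

theorem ae_norm_lt_one_thetaDist (ν : ℝ) : ∀ᵐ z ∂(thetaDist ν), ‖z‖ < 1 := by
  have hD : MeasurableSet {z : ℂ | ‖z‖ < 1} := measurableSet_lt measurable_norm measurable_const
  exact (withDensity_absolutelyContinuous _ _).ae_le (ae_restrict_mem hD)

theorem integrable_thetaDist_norm_pow {ν : ℝ} (hν : 1 < ν) (k : ℕ) :
    Integrable (fun z : ℂ => ‖z‖ ^ k) (thetaDist ν) := by
  have := isProbabilityMeasure_thetaDist hν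
  refine .of_bound (by fun_prop) 1 ((ae_norm_lt_one_thetaDist ν).mono fun z hz => ?_)
  rw [norm_pow, norm_norm]
  exact pow_le_one₀ (norm_nonneg z) hz.le

theorem integral_thetaDist_norm_sq {ν : ℝ} (hν : 1 < ν) :
    ∫ z, ‖z‖ ^ 2 ∂(thetaDist ν) = 2 / (ν + 1) := by
  have := isProbabilityMeasure_thetaDist hν
  have h := integral_thetaDist_one_sub_sq_pow hν 1
  simp only [pow_one] at h
  rw [integral_sub (integrable_const _) (integrable_thetaDist_norm_pow hν 2)] at h
  simp only [integral_const, probReal_univ, smul_eq_mul, mul_one, Nat.cast_one] at h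
  have h1 : ν - 1 + 2 ≠ 0 := by linarith
  have h2 : ν + 1 ≠ 0 := by linarith
  rw [eq_div_iff h1] at h
  rw [eq_div_iff h2]
  linarith

theorem integral_thetaDist_norm_pow_four {ν : ℝ} (hν : 1 < ν) :
    ∫ z, ‖z‖ ^ 4 ∂(thetaDist ν) = 8 / ((ν + 1) * (ν + 3)) := by
  have := isProbabilityMeasure_thetaDist hν
  have h := integral_thetaDist_one_sub_sq_pow hν 2
  have he : ∀ z : ℂ, (1 - ‖z‖ ^ 2) ^ 2 = 1 - 2 * ‖z‖ ^ 2 + ‖z‖ ^ 4 := fun z => by ring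
  have hi : Integrable (fun z : ℂ => 1 - 2 * ‖z‖ ^ 2) (thetaDist ν) :=
    (integrable_const _).sub ((integrable_thetaDist_norm_pow hν 2).const_mul 2)
  simp only [he] at h
  rw [integral_add hi (integrable_thetaDist_norm_pow hν 4), integral_sub (integrable_const _)
    ((integrable_thetaDist_norm_pow hν 2).const_mul 2), integral_const_mul,
    integral_thetaDist_norm_sq hν] at h
  simp only [integral_const, probReal_univ, smul_eq_mul, mul_one, Nat.cast_ofNat] at h
  have h1 : ν + 3 ≠ 0 := by linarith
  have h2 : ν + 1 ≠ 0 := by linarith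
  rw [show ν - 1 + 2 * 2 = ν + 3 by ring] at h
  rw [← eq_sub_iff_add_eq'] at h
  rw [h]
  field_simp
  ring

theorem measurePreserving_mul_thetaDist (ν : ℝ) {c : ℂ} (hc : ‖c‖ = 1) :
    MeasurePreserving (fun z => c * z) (thetaDist ν) (thetaDist ν) := by
  have hD : MeasurableSet {z : ℂ | ‖z‖ < 1} := measurableSet_lt measurable_norm measurable_const
  have hvol : MeasurePreserving (fun z : ℂ => c * z) volume volume :=
    (rotation ⟨c, by simpa [Submonoid.unitSphere] using hc⟩).measurePreserving
  refine ⟨by fun_prop, Measure.ext fun s hs => ?_⟩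
  have hs' : MeasurableSet ((fun z => c * z) ⁻¹' s) := (measurable_const_mul c) hs
  rw [Measure.map_apply (by fun_prop) hs, thetaDist, withDensity_apply _ hs, withDensity_apply _ hs',
    Measure.restrict_restrict hs, Measure.restrict_restrict hs',
    ← hvol.setLIntegral_comp_preimage (hs.inter hD) (measurable_thetaDensity ν)]
  simp [preimage_inter, hc]

theorem measurable_Upsilon1 (φ : ℝ) : Measurable (Upsilon1 φ) := by
  unfold Upsilon1 Upsilon
  fun_prop

theorem integral_thetaDist_eq_integral_circle {ν : ℝ} (hν : 1 < ν) {g : ℂ → ℂ}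
    (hg : Measurable g) {B : ℝ} (hB : ∀ z, ‖g z‖ ≤ B) :
    Integrable (fun z => ∫ t in Ioc (0 : ℝ) 1,
      g (Complex.exp (Complex.I * ((2 * Real.pi * t : ℝ) : ℂ)) * z)) (thetaDist ν) ∧
    ∫ z, g z ∂(thetaDist ν) = ∫ z, (∫ t in Ioc (0 : ℝ) 1,
      g (Complex.exp (Complex.I * ((2 * Real.pi * t : ℝ) : ℂ)) * z)) ∂(thetaDist ν) := by
  have := isProbabilityMeasure_thetaDist hν
  have : IsProbabilityMeasure ((volume : Measure ℝ).restrict (Ioc 0 1)) := ⟨by simp⟩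
  have hint : Integrable (Function.uncurry fun (z : ℂ) (t : ℝ) =>
      g (Complex.exp (Complex.I * ((2 * Real.pi * t : ℝ) : ℂ)) * z))
      ((thetaDist ν).prod ((volume : Measure ℝ).restrict (Ioc 0 1))) :=
    .of_bound (hg.comp (by fun_prop : Measurable fun p : ℂ × ℝ =>
      Complex.exp (Complex.I * ((2 * Real.pi * p.2 : ℝ) : ℂ)) * p.1)).aestronglyMeasurable B
      (.of_forall fun p => hB _)
  refine ⟨hint.integral_prod_left, ?_⟩
  rw [integral_integral_swap hint]
  have hrot : ∀ t : ℝ, ∫ z, g (Complex.exp (Complex.I * ((2 * Real.pi * t : ℝ) : ℂ)) * z)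
      ∂(thetaDist ν) = ∫ z, g z ∂(thetaDist ν) := fun t => by
    have hp := measurePreserving_mul_thetaDist ν
      (Complex.norm_exp_I_mul_ofReal (2 * Real.pi * t))
    rw [← integral_map hp.measurable.aemeasurable hg.aestronglyMeasurable, hp.map_eq]
  simp only [hrot]
  simp

/-- Estimates on the characteristic function of `Υ₁(φ,α)` for `α ∼ Θ_ν`:
`|E[e^{iλΥ₁(φ,α)}] − 1 + 4λ²(1−cos φ)/(ν+1)| ≤ (64λ² + 416λ⁴)/((ν+1)(ν+3))`
and `|E[e^{iλΥ₁(φ,α)}] − 1| ≤ 16λ²/(ν+1)`. -/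
theorem upsilon1_char_estimate (ν : ℝ) (hν : 1 < ν) (φ lam : ℝ)
    {Ω : Type*} [MeasurableSpace Ω] (P : Measure Ω) [IsProbabilityMeasure P]
    (α : Ω → ℂ) (hlaw : Measure.map α P = thetaDist ν) :
    ‖(∫ ω, Complex.exp (Complex.I * ((lam * Upsilon1 φ (α ω) : ℝ) : ℂ)) ∂P) - 1
        + ((4 * lam ^ 2 * (1 - Real.cos φ) / (ν + 1) : ℝ) : ℂ)‖
      ≤ (64 * lam ^ 2 + 416 * lam ^ 4) / ((ν + 1) * (ν + 3)) ∧
    ‖(∫ ω, Complex.exp (Complex.I * ((lam * Upsilon1 φ (α ω) : ℝ) : ℂ)) ∂P) - 1‖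
      ≤ 16 * lam ^ 2 / (ν + 1) := by
  have := isProbabilityMeasure_thetaDist hν
  have hα : AEMeasurable α P := .of_map_ne_zero (hlaw ▸ IsProbabilityMeasure.ne_zero _)
  set g : ℂ → ℂ := fun z => Complex.exp (Complex.I * ((lam * Upsilon1 φ z : ℝ) : ℂ)) with hgdef
  have hg : Measurable g := by
    have := measurable_Upsilon1 φ
    fun_prop
  obtain ⟨hint, hE⟩ := integral_thetaDist_eq_integral_circle hν hg (B := 1)
    fun z => (Complex.norm_exp_I_mul_ofReal _).le
  have hP : ∫ ω, Complex.exp (Complex.I * ((lam * Upsilon1 φ (α ω) : ℝ) : ℂ)) ∂P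
      = ∫ z, g z ∂(thetaDist ν) := by
    rw [← hlaw, integral_map hα hg.aestronglyMeasurable]
  rw [hP, hE]
  set A : ℂ → ℂ := fun z => ∫ t in Ioc (0 : ℝ) 1,
    g (Complex.exp (Complex.I * ((2 * Real.pi * t : ℝ) : ℂ)) * z) with hA
  have hA1 : (∫ z, A z ∂(thetaDist ν)) - 1 = ∫ z, (A z - 1) ∂(thetaDist ν) := by
    rw [integral_sub hint (integrable_const _)]
    simp
  have hA1i : Integrable (fun z => A z - 1) (thetaDist ν) := hint.sub (integrable_const _)
  have hsqi : Integrable (fun z : ℂ => ((2 * lam ^ 2 * (1 - Real.cos φ) * ‖z‖ ^ 2 : ℝ) : ℂ))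
      (thetaDist ν) := ((integrable_thetaDist_norm_pow hν 2).const_mul _).ofReal
  have hsq : ((4 * lam ^ 2 * (1 - Real.cos φ) / (ν + 1) : ℝ) : ℂ)
      = ∫ z : ℂ, ((2 * lam ^ 2 * (1 - Real.cos φ) * ‖z‖ ^ 2 : ℝ) : ℂ) ∂(thetaDist ν) := by
    rw [integral_complex_ofReal, integral_const_mul, integral_thetaDist_norm_sq hν]
    congr 1
    ring
  constructor
  · rw [hA1, hsq, ← integral_add hA1i hsqi]
    calc _ ≤ ∫ z : ℂ, (8 * lam ^ 2 + 52 * lam ^ 4) * ‖z‖ ^ 4 ∂(thetaDist ν) :=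
          norm_integral_le_of_norm_le ((integrable_thetaDist_norm_pow hν 4).const_mul _)
            ((ae_norm_lt_one_thetaDist ν).mono fun z hz =>
              (circle_average_Upsilon1_bounds φ lam hz).1)
      _ = _ := by
          rw [integral_const_mul, integral_thetaDist_norm_pow_four hν]
          ring
  · rw [hA1]
    calc _ ≤ ∫ z : ℂ, 8 * lam ^ 2 * ‖z‖ ^ 2 ∂(thetaDist ν) :=
          norm_integral_le_of_norm_le ((integrable_thetaDist_norm_pow hν 2).const_mul _)
            ((ae_norm_lt_one_thetaDist ν).mono fun z hz =>
              (circle_average_Upsilon1_bounds φ lam hz).2)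
      _ = _ := by
          rw [integral_const_mul, integral_thetaDist_norm_sq hν]
          ring
end
end

section
/- Let (ε_j)_{j≥0} be positive reals, (a_j), (b_j), (c_j) complex sequences, n a positive integer and λ ∈ ℝ, such that |a_j| ≤ 1 for all j and a_{j+1} − a_j + λ²(ε_j a_j − b_j) = c_j for all j. Set s_k = Σ_{j=0}^{k−1} ε_j and t_k = Σ_{j=k}^{n−1} b_j. Then for every integer k with 0 ≤ k ≤ n−1: | e^{λ² s_k} a_k − e^{λ² s_n} a_n | ≤ e^{λ² s_k} λ² |t_k| + Σ_{j=k}^{n−1} e^{λ² s_{j+1}} ( |c_j| + λ⁴ ε_j²/2 + λ⁴ |ε_j t_j| ). -/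
open Finset

theorem exp_neg_le_quadratic {x : ℝ} (hx : 0 ≤ x) : Real.exp (-x) ≤ 1 - x + x ^ 2 / 2 := by
  have h1 := Real.quadratic_le_exp_of_nonneg hx
  have h2 : 0 < 1 - x + x ^ 2 / 2 := by nlinarith [sq_nonneg (x - 1)]
  rw [Real.exp_neg, inv_le_iff_one_le_mul₀ (Real.exp_pos x)]
  nlinarith [mul_le_mul_of_nonneg_left h1 h2.le, sq_nonneg (x ^ 2)]

/-- One step of the recursion for the corrected quantity `E (a + μ t)`, where `E` grows by
the factor `exp (μ ε)` and `t` decreases by `b`. -/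
theorem norm_step_le {E E' μ ε : ℝ} {a a' b c t t' : ℂ} (hE' : 0 < E')
    (hE : E = E' * Real.exp (-(μ * ε))) (hμ : 0 ≤ μ) (hε : 0 ≤ ε) (ha : ‖a‖ ≤ 1)
    (hrec : a' - a + (μ : ℂ) * ((ε : ℂ) * a - b) = c) (ht : t = b + t') :
    ‖(E' : ℂ) * (a' + μ * t') - (E : ℂ) * (a + μ * t)‖
      ≤ E' * (‖c‖ + μ ^ 2 * ε ^ 2 / 2 + μ ^ 2 * ‖(ε : ℂ) * t‖) := by
  have hx : 0 ≤ μ * ε := mul_nonneg hμ hε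
  have hlow := Real.one_sub_le_exp_neg (μ * ε)
  have hup := exp_neg_le_quadratic hx
  have hone : Real.exp (-(μ * ε)) ≤ 1 := Real.exp_le_one_iff.2 (by linarith)
  set y := Real.exp (-(μ * ε))
  have key : (E' : ℂ) * (a' + μ * t') - (E : ℂ) * (a + μ * t)
      = (E' : ℂ) * (c + ((1 - μ * ε - y : ℝ) : ℂ) * a + ((μ * (1 - y) : ℝ) : ℂ) * t) := by
    rw [hE, ht, ← hrec]
    push_cast
    ring
  have hquad : ‖((1 - μ * ε - y : ℝ) : ℂ) * a‖ ≤ μ ^ 2 * ε ^ 2 / 2 := by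
    rw [norm_mul, Complex.norm_real, Real.norm_eq_abs]
    have habs : |1 - μ * ε - y| ≤ μ ^ 2 * ε ^ 2 / 2 := abs_le.2 ⟨by nlinarith, by nlinarith⟩
    exact (mul_le_of_le_one_right (abs_nonneg _) ha).trans habs
  have hlin : ‖((μ * (1 - y) : ℝ) : ℂ) * t‖ ≤ μ ^ 2 * ‖(ε : ℂ) * t‖ := by
    rw [norm_mul, norm_mul, Complex.norm_real, Complex.norm_real, Real.norm_of_nonneg hε,
      Real.norm_of_nonneg (mul_nonneg hμ (by linarith)), ← mul_assoc]
    refine mul_le_mul_of_nonneg_right ?_ (norm_nonneg t)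
    nlinarith
  rw [key, norm_mul, Complex.norm_real, Real.norm_of_nonneg hE'.le]
  gcongr
  exact norm_add₃_le.trans (by gcongr)

/-- Deterministic sequence lemma: if `|a_j| ≤ 1`, `ε_j > 0` and
`a_{j+1} − a_j + λ²(ε_j a_j − b_j) = c_j`, then with `s_k = Σ_{j<k} ε_j` and
`t_k = Σ_{j=k}^{n−1} b_j`, for `0 ≤ k ≤ n−1`:
`|e^{λ²s_k} a_k − e^{λ²s_n} a_n| ≤ e^{λ²s_k} λ² |t_k|
  + Σ_{j=k}^{n−1} e^{λ²s_{j+1}} (|c_j| + λ⁴ε_j²/2 + λ⁴|ε_j t_j|)`. -/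
theorem sequence_comparison_lemma (ε : ℕ → ℝ) (a b c : ℕ → ℂ) (n : ℕ) (hn : 0 < n)
    (lam : ℝ) (hε : ∀ j, 0 < ε j) (ha : ∀ j, ‖a j‖ ≤ 1)
    (hrec : ∀ j, a (j + 1) - a j + ((lam ^ 2 : ℝ) : ℂ) * (((ε j : ℝ) : ℂ) * a j - b j) = c j) :
    ∀ k : ℕ, k < n →
      ‖(Real.exp (lam ^ 2 * ∑ j ∈ range k, ε j) : ℂ) * a k
          - (Real.exp (lam ^ 2 * ∑ j ∈ range n, ε j) : ℂ) * a n‖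
        ≤ Real.exp (lam ^ 2 * ∑ j ∈ range k, ε j) * lam ^ 2 * ‖∑ j ∈ Ico k n, b j‖
          + ∑ j ∈ Ico k n, Real.exp (lam ^ 2 * ∑ i ∈ range (j + 1), ε i) *
              (‖c j‖ + lam ^ 4 * (ε j) ^ 2 / 2
                + lam ^ 4 * ‖((ε j : ℝ) : ℂ) * ∑ i ∈ Ico j n, b i‖) := by
  intro k hk
  set E : ℕ → ℝ := fun j ↦ Real.exp (lam ^ 2 * ∑ i ∈ range j, ε i) with hEdef
  set t : ℕ → ℂ := fun j ↦ ∑ i ∈ Ico j n, b i with htdef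
  set F : ℕ → ℂ := fun j ↦ (E j : ℂ) * (a j + ((lam ^ 2 : ℝ) : ℂ) * t j) with hFdef
  have hstep : ∀ j ∈ Ico k n, ‖F (j + 1) - F j‖ ≤ E (j + 1) *
      (‖c j‖ + lam ^ 4 * (ε j) ^ 2 / 2 + lam ^ 4 * ‖((ε j : ℝ) : ℂ) * t j‖) := by
    intro j hj
    have hE : E j = E (j + 1) * Real.exp (-(lam ^ 2 * ε j)) := by
      simp only [hEdef]
      rw [← Real.exp_add, sum_range_succ]
      ring_nf
    have h := norm_step_le (Real.exp_pos _) hE (sq_nonneg lam) (hε j).le (ha j) (hrec j)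
      (sum_eq_sum_Ico_succ_bot (mem_Ico.1 hj).2 b)
    rwa [← pow_mul] at h
  have hsum : ‖F n - F k‖ ≤ ∑ j ∈ Ico k n, E (j + 1) *
      (‖c j‖ + lam ^ 4 * (ε j) ^ 2 / 2 + lam ^ 4 * ‖((ε j : ℝ) : ℂ) * t j‖) := by
    rw [← sum_Ico_sub F hk.le]
    exact norm_sum_le_of_le _ hstep
  have hsplit : (E k : ℂ) * a k - (E n : ℂ) * a n
      = -(((E k * lam ^ 2 : ℝ) : ℂ) * t k) - (F n - F k) := by
    have htn : t n = 0 := by simp [htdef]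
    simp only [hFdef, htn]
    push_cast
    ring
  have hboundary : ‖((E k * lam ^ 2 : ℝ) : ℂ) * t k‖ = E k * lam ^ 2 * ‖t k‖ := by
    rw [norm_mul, Complex.norm_real,
      Real.norm_of_nonneg (mul_nonneg (Real.exp_pos _).le (sq_nonneg lam))]
  change ‖(E k : ℂ) * a k - (E n : ℂ) * a n‖ ≤ _
  rw [hsplit]
  refine (norm_sub_le _ _).trans (add_le_add ?_ hsum)
  rw [norm_neg, hboundary]
end
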